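/- Assume f_1 ≥ f_2 ≥ … ≥ f_n ≥ 0 and b_1 ≥ b_2 ≥ … ≥ b_m. Then the northwest-corner (greedy) solution x^g satisfies cost_f(x^g) ≤ 2 · cost_f(y) for every y ∈ 𝒳; that is, the greedy algorithm is a 2-approximation for the Pure Fixed Charge Transportation problem with Sink-Independent Fixed Costs (PFCT-S). -/

import Mathlib

open Finset

/-- Sum of the first `t` entries of a vector indexed by `Fin k`. -/
def partialSum {k : ℕ} (c : Fin k → ℤ) (t : ℕ) : ℤ :=
  ∑ i : Fin k, if (i : ℕ) < t then c i else 0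

/-- PFCT-S cost of a solution `x`: `∑_{(i,j) : x_{ij} > 0} f_i`. -/
noncomputable def costF {n m : ℕ} (f : Fin n → ℝ) (x : Fin n → Fin m → ℝ) : ℝ :=
  ∑ i : Fin n, ∑ j : Fin m, if 0 < x i j then f i else 0

/-- The northwest-corner (greedy) solution
`x^g_{ij} = max(0, min(A_i, B_j) − max(A_{i−1}, B_{j−1}))`. -/
def greedy {n m : ℕ} (a : Fin n → ℤ) (b : Fin m → ℤ) : Fin n → Fin m → ℝ :=
  fun i j =>
    max 0 (min ((partialSum a ((i : ℕ) + 1) : ℤ) : ℝ) ((partialSum b ((j : ℕ) + 1) : ℤ) : ℝ)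
      - max ((partialSum a (i : ℕ) : ℤ) : ℝ) ((partialSum b (j : ℕ) : ℤ) : ℝ))

theorem mul_sum_le_sum_mul_of_antitone {n : ℕ} (f u : Fin n → ℝ) (c : ℝ)
    (hf : Antitone f) (hc : ∀ i, c ≤ f i)
    (hu : ∀ k : ℕ, 0 ≤ ∑ i : Fin n, if (i : ℕ) < k then u i else 0) :
    c * ∑ i, u i ≤ ∑ i, f i * u i := by
  induction n generalizing c with
  | zero => simp
  | succ n ih =>
    have hprefix (k : ℕ) : 0 ≤ ∑ i : Fin n, if (i : ℕ) < k then u i.castSucc else 0 := by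
      have h := hu (min k n)
      rw [Fin.sum_univ_castSucc] at h
      simpa [Fin.is_lt] using h
    have hstep := ih (fun i => f i.castSucc) (fun i => u i.castSucc) (f (Fin.last n))
      (fun i j hij => hf (Fin.castSucc_le_castSucc_iff.mpr hij))
      (fun i => hf (Fin.le_last _)) hprefix
    have htotal : 0 ≤ ∑ i, u i := by
      have h := hu (n + 1)
      simpa only [Fin.is_lt, if_true] using h
    have hlast := mul_le_mul_of_nonneg_right (hc (Fin.last n)) htotal
    rw [Fin.sum_univ_castSucc (fun i => f i * u i)]
    rw [Fin.sum_univ_castSucc u] at hlast ⊢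
    linarith

theorem partialSum_mono {k : ℕ} {c : Fin k → ℤ} (hc : ∀ i, 0 ≤ c i) :
    Monotone (partialSum c) := by
  intro s t hst
  refine sum_le_sum fun i _ => ?_
  have := hc i
  split_ifs <;> omega

/-- The prefix of length `#S` has the largest sum among sets of its size. -/
theorem sum_le_partialSum_card {m : ℕ} {b : Fin m → ℤ} (hb : Antitone b)
    (S : Finset (Fin m)) (hS : #S < m) : ∑ j ∈ S, b j ≤ partialSum b #S := by
  set c := b ⟨#S, hS⟩ with hc
  have hcard : #{j : Fin m | (j : ℕ) < #S} = #S := by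
    simp [Fin.card_filter_val_lt, hS.le]
  have h : ∑ j ∈ S, (b j - c) ≤ ∑ j : Fin m with Fin.val j < #S, (b j - c) := by
    rw [← sum_filter_add_sum_filter_not S (fun j : Fin m => (j : ℕ) < #S)]
    have hneg : ∑ j ∈ S with ¬ Fin.val j < #S, (b j - c) ≤ 0 := by
      refine sum_nonpos fun j hj => sub_nonpos.mpr (hb ?_)
      simpa [Fin.le_def] using (mem_filter.mp hj).2
    have hpos : ∑ j ∈ S with Fin.val j < #S, (b j - c) ≤
        ∑ j : Fin m with Fin.val j < #S, (b j - c) := by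
      refine sum_le_sum_of_subset_of_nonneg (filter_subset_filter _ (subset_univ _)) ?_
      intro j hj _
      exact sub_nonneg.mpr (hb (Fin.le_def.mpr (mem_filter.mp hj).2.le))
    linarith
  rw [sum_sub_distrib, sum_sub_distrib, sum_const, sum_const, hcard] at h
  rw [partialSum, ← sum_filter]
  linarith

theorem greedy_pos_iff {n m : ℕ} (a : Fin n → ℤ) (b : Fin m → ℤ) (i : Fin n) (j : Fin m) :
    0 < greedy a b i j ↔
      max (partialSum a i) (partialSum b j) < min (partialSum a (i + 1)) (partialSum b (j + 1)) := by
  rw [greedy, lt_max_iff, sub_pos]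
  simp only [lt_self_iff_false, false_or]
  norm_cast

/-- The cells in the first `k` rows where `x` is positive. -/
noncomputable def rowPrefixSupport {n m : ℕ} (x : Fin n → Fin m → ℝ) (k : ℕ) :
    Finset (Fin n × Fin m) := {p | (p.1 : ℕ) < k ∧ 0 < x p.1 p.2}

theorem mem_rowPrefixSupport {n m : ℕ} {x : Fin n → Fin m → ℝ} {k : ℕ} {p : Fin n × Fin m} :
    p ∈ rowPrefixSupport x k ↔ (p.1 : ℕ) < k ∧ 0 < x p.1 p.2 := by
  simp [rowPrefixSupport]

theorem card_rowPrefixSupport {n m : ℕ} (x : Fin n → Fin m → ℝ) (k : ℕ) :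
    #(rowPrefixSupport x k) = ∑ i : Fin n, if (i : ℕ) < k then #{j | 0 < x i j} else 0 := by
  rw [rowPrefixSupport, card_filter, Fintype.sum_prod_type]
  refine sum_congr rfl fun i _ => ?_
  by_cases h : (i : ℕ) < k <;> simp [h]

theorem costF_eq_sum_mul_card {n m : ℕ} (f : Fin n → ℝ) (x : Fin n → Fin m → ℝ) :
    costF f x = ∑ i, f i * (#{j | 0 < x i j} : ℝ) := by
  refine sum_congr rfl fun i _ => ?_
  rw [← sum_filter, sum_const, nsmul_eq_mul, mul_comm]

theorem card_rowPrefixSupport_greedy_le {n m : ℕ} {a : Fin n → ℤ} {b : Fin m → ℤ}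
    (ha : ∀ i, 0 ≤ a i) (hb : ∀ j, 0 ≤ b j) (k : ℕ) :
    #(rowPrefixSupport (greedy a b) k) ≤
      #{i : Fin n | (i : ℕ) < k} + #{j : Fin m | partialSum b j < partialSum a k} := by
  rw [← card_filter_add_card_filter_not
    (fun p : Fin n × Fin m => partialSum b p.2 ≤ partialSum a p.1)]
  refine add_le_add (card_le_card_of_injOn Prod.fst ?_ ?_)
    (card_le_card_of_injOn Prod.snd ?_ ?_)
  · intro p hp
    simp only [coe_filter, mem_rowPrefixSupport, Set.mem_ofPred_eq] at hp
    simpa using hp.1.1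
  · rintro ⟨i, j⟩ hp ⟨i', j'⟩ hq h
    simp only [coe_filter, mem_rowPrefixSupport, Set.mem_ofPred_eq, greedy_pos_iff,
      max_lt_iff, lt_min_iff] at hp hq h
    subst h
    rcases lt_trichotomy j j' with h | h | h
    · have := partialSum_mono hb (show (j : ℕ) + 1 ≤ j' from h)
      omega
    · rw [h]
    · have := partialSum_mono hb (show (j' : ℕ) + 1 ≤ j from h)
      omega
  · intro p hp
    simp only [coe_filter, mem_rowPrefixSupport, Set.mem_ofPred_eq, greedy_pos_iff,
      max_lt_iff, lt_min_iff] at hp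
    have := partialSum_mono ha (show (p.1 : ℕ) + 1 ≤ k from hp.1.1)
    simp only [coe_filter, mem_univ, true_and, Set.mem_ofPred_eq]
    omega
  · rintro ⟨i, j⟩ hp ⟨i', j'⟩ hq h
    simp only [coe_filter, mem_rowPrefixSupport, Set.mem_ofPred_eq, greedy_pos_iff,
      max_lt_iff, lt_min_iff] at hp hq h
    subst h
    rcases lt_trichotomy i i' with h | h | h
    · have := partialSum_mono ha (show (i : ℕ) + 1 ≤ i' from h)
      omega
    · rw [h]
    · have := partialSum_mono ha (show (i' : ℕ) + 1 ≤ i from h)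
      omega

theorem card_rows_le_card_rowPrefixSupport {n m : ℕ} {a : Fin n → ℤ} (ha : ∀ i, 0 < a i)
    {y : Fin n → Fin m → ℝ} (hy_row : ∀ i, ∑ j, y i j = (a i : ℝ)) (k : ℕ) :
    #{i : Fin n | (i : ℕ) < k} ≤ #(rowPrefixSupport y k) := by
  refine card_le_card_of_surjOn Prod.fst fun i hi => ?_
  have hpos : ∑ _j : Fin m, (0 : ℝ) < ∑ j, y i j := by
    simpa [hy_row] using ha i
  obtain ⟨j, -, hj⟩ := exists_lt_of_sum_lt hpos
  exact ⟨(i, j), mem_coe.mpr (mem_rowPrefixSupport.mpr ⟨by simpa using hi, hj⟩), rfl⟩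

theorem card_sinks_le_card_rowPrefixSupport {n m : ℕ} {a : Fin n → ℤ} {b : Fin m → ℤ}
    (hb : ∀ j, 0 ≤ b j) (hbmono : Antitone b) {y : Fin n → Fin m → ℝ}
    (hy_nonneg : ∀ i j, 0 ≤ y i j) (hy_row : ∀ i, ∑ j, y i j = (a i : ℝ))
    (hy_col : ∀ j, ∑ i, y i j = (b j : ℝ)) (k : ℕ) :
    #{j : Fin m | partialSum b j < partialSum a k} ≤ #(rowPrefixSupport y k) := by
  set S : Finset (Fin m) := (rowPrefixSupport y k).image Prod.snd with hS
  refine le_trans ?_ (card_image_le (s := rowPrefixSupport y k) (f := Prod.snd))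
  rw [← hS]
  have hsupply : partialSum a k ≤ ∑ j ∈ S, b j := by
    have h : ((partialSum a k : ℤ) : ℝ) ≤ ∑ j ∈ S, (b j : ℝ) := calc
      ((partialSum a k : ℤ) : ℝ) = ∑ i : Fin n with Fin.val i < k, ∑ j, y i j := by
        simp only [partialSum, ← sum_filter, Int.cast_sum, hy_row]
      _ = ∑ j, ∑ i : Fin n with Fin.val i < k, y i j := sum_comm
      _ = ∑ j ∈ S, ∑ i : Fin n with Fin.val i < k, y i j := by
        refine (sum_subset (subset_univ S) fun j _ hj => sum_eq_zero fun i hi => ?_).symm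
        by_contra hne
        exact hj (mem_image.mpr ⟨(i, j), mem_rowPrefixSupport.mpr
          ⟨(mem_filter.mp hi).2, (hy_nonneg i j).lt_of_ne' hne⟩, rfl⟩)
      _ ≤ ∑ j ∈ S, ∑ i, y i j := sum_le_sum fun j _ =>
        sum_le_sum_of_subset_of_nonneg (subset_univ _) fun i _ _ => hy_nonneg i j
      _ = ∑ j ∈ S, (b j : ℝ) := by simp only [hy_col]
    exact_mod_cast h
  by_contra! hlt
  have hex : ∃ j : Fin m, partialSum b j < partialSum a k ∧ #S ≤ (j : ℕ) := by
    by_contra! hall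
    refine hlt.not_ge ?_
    calc #{j : Fin m | partialSum b j < partialSum a k}
        ≤ #(range #S) := card_le_card_of_injOn Fin.val
          (fun j hj => by simpa using hall j (by simpa using hj)) Fin.val_injective.injOn
      _ = #S := card_range _
  obtain ⟨j, hj, hSj⟩ := hex
  have := sum_le_partialSum_card hbmono S (hSj.trans_lt j.isLt)
  have := partialSum_mono hb hSj
  omega

/-- the greedy (northwest-corner) solution is a 2-approximation for PFCT-S:
its cost is at most twice the cost of any feasible solution `y ∈ 𝒳`. -/
theorem stmt_3
    (n m : ℕ) (hn : 0 < n) (hm : 0 < m)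
    (a : Fin n → ℤ) (ha : ∀ i, 0 < a i)
    (b : Fin m → ℤ) (hb : ∀ j, 0 < b j)
    (hab : ∑ i, a i = ∑ j, b j)
    (f : Fin n → ℝ) (hf0 : ∀ i, 0 ≤ f i)
    (hfmono : ∀ i i' : Fin n, i ≤ i' → f i' ≤ f i)
    (hbmono : ∀ j j' : Fin m, j ≤ j' → b j' ≤ b j)
    (y : Fin n → Fin m → ℝ)
    (hy_nonneg : ∀ i j, 0 ≤ y i j)
    (hy_row : ∀ i, ∑ j, y i j = (a i : ℝ))
    (hy_col : ∀ j, ∑ i, y i j = (b j : ℝ)) :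
    costF f (greedy a b) ≤ 2 * costF f y := by
  have hmain := mul_sum_le_sum_mul_of_antitone f
    (fun i => 2 * (#{j | 0 < y i j} : ℝ) - (#{j | 0 < greedy a b i j} : ℝ)) 0
    (fun i i' h => hfmono i i' h) hf0 ?_
  · rw [costF_eq_sum_mul_card, costF_eq_sum_mul_card, mul_sum, ← sub_nonneg, ← sum_sub_distrib]
    rw [zero_mul] at hmain
    exact hmain.trans_eq (sum_congr rfl fun i _ => by ring)
  · intro k
    have hgreedy := card_rowPrefixSupport_greedy_le (fun i => (ha i).le) (fun j => (hb j).le) k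
    have hrows := card_rows_le_card_rowPrefixSupport ha hy_row k
    have hsinks := card_sinks_le_card_rowPrefixSupport (fun j => (hb j).le)
      (fun j j' h => hbmono j j' h) hy_nonneg hy_row hy_col k
    have hle : #(rowPrefixSupport (greedy a b) k) ≤ 2 * #(rowPrefixSupport y k) := by omega
    rw [card_rowPrefixSupport, card_rowPrefixSupport] at hle
    have hcast := (Nat.cast_le (α := ℝ)).mpr hle
    push_cast at hcast
    rw [← sub_nonneg, mul_sum, ← sum_sub_distrib] at hcast
    refine hcast.trans_eq (sum_congr rfl fun i _ => ?_)
    split_ifs <;> simp
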